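/- Let M : ℝ → ℂ^{p×m}, σ : ℝ → ℝ, u : ℝ → ℂ^p, and v : ℝ → ℂ^m be differentiable at 0, and suppose that for all t in a neighborhood of 0: M(t) v(t) = σ(t) u(t), M(t)ᴴ u(t) = σ(t) v(t), ‖u(t)‖ = 1, and ‖v(t)‖ = 1 (Euclidean norms). Then σ′(0) = Re( u(0)ᴴ M′(0) v(0) ). -/

import Mathlib

open Matrix

theorem HasDerivAt.dotProduct_of_pi {n 𝔸 : Type*} [Fintype n] [NormedCommRing 𝔸]
    [NormedAlgebra ℝ 𝔸] {x y : ℝ → n → 𝔸} {x' y' : n → 𝔸} {t : ℝ}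
    (hx : ∀ i, HasDerivAt (fun s => x s i) (x' i) t)
    (hy : ∀ i, HasDerivAt (fun s => y s i) (y' i) t) :
    HasDerivAt (fun s => x s ⬝ᵥ y s) (x' ⬝ᵥ y t + x t ⬝ᵥ y') t := by
  simp only [dotProduct, ← Finset.sum_add_distrib]
  exact HasDerivAt.fun_sum fun i _ => (hx i).mul (hy i)

theorem star_dotProduct_self_eq_one_of_norm {n : ℕ} {x : Fin n → ℂ}
    (hx : ‖(EuclideanSpace.equiv (Fin n) ℂ).symm x‖ = 1) : star x ⬝ᵥ x = 1 := by
  have h := inner_self_eq_norm_sq_to_K (𝕜 := ℂ) ((EuclideanSpace.equiv (Fin n) ℂ).symm x)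
  rw [hx, EuclideanSpace.inner_eq_star_dotProduct, dotProduct_comm] at h
  simpa using h

/-- The velocity of a path of unit vectors is orthogonal to the path, in the real sense. -/
theorem re_star_dotProduct_deriv_eq_zero {n : Type*} [Fintype n] {x : ℝ → n → ℂ} {x' : n → ℂ}
    {t : ℝ} (hx : ∀ i, HasDerivAt (fun s => x s i) (x' i) t)
    (hone : ∀ᶠ s in nhds t, star (x s) ⬝ᵥ x s = 1) : (star (x t) ⬝ᵥ x').re = 0 := by
  have h := HasDerivAt.dotProduct_of_pi (x := fun s => star (x s)) (x' := star x')
    (fun i => (hx i).star) hx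
  have h0 := h.unique ((hasDerivAt_const t (1 : ℂ)).congr_of_eventuallyEq hone)
  have hc : star x' ⬝ᵥ x t = star (star (x t) ⬝ᵥ x') := by
    rw [star_dotProduct]
  rw [hc] at h0
  have := congrArg Complex.re h0
  simp only [Complex.add_re, Complex.star_def, Complex.conj_re, Complex.zero_re] at this
  linarith

/-- First-order perturbation formula for a singular value: if `M(t) v(t) = σ(t) u(t)`,
`M(t)ᴴ u(t) = σ(t) v(t)`, with `u(t)`, `v(t)` of Euclidean norm one near `t = 0`, and
all data differentiable at `0`, then `σ′(0) = Re(u(0)ᴴ M′(0) v(0))`. -/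
theorem singular_value_derivative
    {p m : ℕ}
    (M : ℝ → Matrix (Fin p) (Fin m) ℂ) (σ : ℝ → ℝ)
    (u : ℝ → (Fin p → ℂ)) (v : ℝ → (Fin m → ℂ))
    (hM : ∀ i j, DifferentiableAt ℝ (fun t => M t i j) 0)
    (hσ : DifferentiableAt ℝ σ 0)
    (hu : ∀ i, DifferentiableAt ℝ (fun t => u t i) 0)
    (hv : ∀ j, DifferentiableAt ℝ (fun t => v t j) 0)
    (hsing₁ : ∀ᶠ t in nhds (0 : ℝ), M t *ᵥ v t = (σ t : ℂ) • u t)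
    (hsing₂ : ∀ᶠ t in nhds (0 : ℝ), (M t)ᴴ *ᵥ u t = (σ t : ℂ) • v t)
    (hunorm : ∀ᶠ t in nhds (0 : ℝ),
      ‖(EuclideanSpace.equiv (Fin p) ℂ).symm (u t)‖ = 1)
    (hvnorm : ∀ᶠ t in nhds (0 : ℝ),
      ‖(EuclideanSpace.equiv (Fin m) ℂ).symm (v t)‖ = 1)
    (M' : Matrix (Fin p) (Fin m) ℂ)
    (hM' : M' = Matrix.of fun i j => deriv (fun t => M t i j) 0) :
    deriv σ 0 = ((star (u 0)) ⬝ᵥ (M' *ᵥ v 0)).re := by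
  have hM0 : ∀ i j, HasDerivAt (fun t => M t i j) (M' i j) 0 := fun i j => by
    simpa [hM'] using (hM i j).hasDerivAt
  have hu0 := fun i => (hu i).hasDerivAt
  have hv0 := fun j => (hv j).hasDerivAt
  set u' : Fin p → ℂ := fun i => deriv (fun t => u t i) 0
  set v' : Fin m → ℂ := fun j => deriv (fun t => v t j) 0
  have hu1 := hunorm.mono fun t => star_dotProduct_self_eq_one_of_norm
  have hv1 := hvnorm.mono fun t => star_dotProduct_self_eq_one_of_norm
  have hure : (star (u 0) ⬝ᵥ u').re = 0 := re_star_dotProduct_deriv_eq_zero hu0 hu1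
  have hvre : (star (v 0) ⬝ᵥ v').re = 0 := re_star_dotProduct_deriv_eq_zero hv0 hv1
  have hMv : ∀ i, HasDerivAt (fun t => (M t *ᵥ v t) i) ((M' *ᵥ v 0 + M 0 *ᵥ v') i) 0 :=
    fun i => HasDerivAt.dotProduct_of_pi (hM0 i) hv0
  have hform := HasDerivAt.dotProduct_of_pi (x := fun t => star (u t)) (x' := star u')
    (fun i => (hu0 i).star) hMv
  have hσform : (fun t => (σ t : ℂ)) =ᶠ[nhds 0] fun t => star (u t) ⬝ᵥ (M t *ᵥ v t) := by
    filter_upwards [hsing₁, hu1] with t h₁ h₂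
    rw [h₁, dotProduct_smul, h₂, smul_eq_mul, mul_one]
  have hderiv := hσ.hasDerivAt.ofReal_comp.unique (hform.congr_of_eventuallyEq hσform)
  have hleft : star u' ⬝ᵥ (M 0 *ᵥ v 0) = (σ 0 : ℂ) * star (star (u 0) ⬝ᵥ u') := by
    rw [hsing₁.self_of_nhds, dotProduct_smul, smul_eq_mul, star_dotProduct]
  have hright : star (u 0) ⬝ᵥ (M 0 *ᵥ v') = (σ 0 : ℂ) * (star (v 0) ⬝ᵥ v') := by
    have h := congrArg star hsing₂.self_of_nhds
    rw [star_mulVec, conjTranspose_conjTranspose] at h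
    rw [dotProduct_mulVec, h, star_smul, smul_dotProduct, smul_eq_mul, Complex.star_def,
      Complex.conj_ofReal]
  rw [dotProduct_add, hleft, hright] at hderiv
  have hre := congrArg Complex.re hderiv
  simpa only [Complex.add_re, Complex.re_ofReal_mul, Complex.ofReal_re, Complex.star_def,
    Complex.conj_re, hure, hvre, mul_zero, zero_add, add_zero] using hre
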